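/- Almost surely, the sequence of random finite measures (B̄_n)_{n≥0} on C converges weakly to a random finite measure W, and W is supported on ∂_harm, the support of the law of X_∞ under 𝐏_o (the smallest closed subset of ∂ with 𝐏_o(X_∞ ∈ ∂_harm) = 1). -/

import Mathlib

open MeasureTheory Filter Topology

/-- The (rescaled) branching random walk configuration `w : S → ℝ≥0∞`, viewed as a finite
measure on the compactification `C` via the embedding `ι`: the measure `∑ₓ w(x) δ_{ι(x)}`. -/
noncomputable def brwMeasure {S C : Type*} [MeasurableSpace C] (ι : S → C) (w : S → ENNReal) :
    MeasureTheory.Measure C :=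
  MeasureTheory.Measure.sum fun x => w x • MeasureTheory.Measure.dirac (ι x)

/-- `W` is a subsequential weak limit of the sequence of finite measures `μs` on `C`:
along some strictly increasing subsequence, the integrals of every bounded continuous
function converge to the corresponding integral against `W`. -/
def IsSubseqWeakLimit {C : Type*} [TopologicalSpace C] [MeasurableSpace C]
    (μs : ℕ → MeasureTheory.Measure C) (W : MeasureTheory.Measure C) : Prop :=
  ∃ φ : ℕ → ℕ, StrictMono φ ∧
    ∀ f : BoundedContinuousFunction C ℝ,
      Filter.Tendsto (fun k => ∫ c, f c ∂(μs (φ k))) Filter.atTop (nhds (∫ c, f c ∂W))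

/-- The action `u ↦ ∑ᵧ p(x,y) u(y)` of a kernel on non-negative functions. -/
noncomputable def kernelOp {S : Type*} (p : S → S → ENNReal) (u : S → ENNReal) : S → ENNReal :=
  fun x => ∑' y, p x y * u y

/-- An adapted process of non-negative weights on `S` started from the unit mass at `o`, whose
expected one-step evolution is given by the kernel `p`. -/
structure IsBranchingWeight {S Ω : Type*} [DecidableEq S] {mΩ : MeasurableSpace Ω}
    (μ : Measure Ω) (F : Filtration ℕ mΩ) (p : S → S → ENNReal) (o : S)
    (w : ℕ → Ω → S → ENNReal) : Prop where
  measurable : ∀ n x, Measurable[F n] fun ω => w n ω x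
  start : ∀ ω x, w 0 ω x = if x = o then 1 else 0
  step : ∀ n x A, MeasurableSet[F n] A →
    ∫⁻ ω in A, w (n + 1) ω x ∂μ = ∫⁻ ω in A, ∑' y, w n ω y * p y x ∂μ

/-- Almost sure convergence of non-negative supermartingales, in `ℝ≥0∞`-valued form. -/
theorem ae_exists_tendsto_of_setLIntegral_succ_le {Ω : Type*} {mΩ : MeasurableSpace Ω}
    {μ : Measure Ω} [IsFiniteMeasure μ] {F : Filtration ℕ mΩ} {Z : ℕ → Ω → ENNReal}
    (hZ : ∀ n, Measurable[F n] (Z n)) (h0 : ∫⁻ ω, Z 0 ω ∂μ ≠ ⊤)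
    (hstep : ∀ n A, MeasurableSet[F n] A → ∫⁻ ω in A, Z (n + 1) ω ∂μ ≤ ∫⁻ ω in A, Z n ω ∂μ) :
    ∀ᵐ ω ∂μ, ∃ l, l ≠ ⊤ ∧ Tendsto (fun n => Z n ω) atTop (𝓝 l) := by
  have hZ' : ∀ n, Measurable (Z n) := fun n => (hZ n).mono (F.le n) le_rfl
  have hle : ∀ n, ∫⁻ ω, Z n ω ∂μ ≤ ∫⁻ ω, Z 0 ω ∂μ := by
    intro n
    induction n with
    | zero => exact le_rfl
    | succ n ih =>
      refine le_trans ?_ ih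
      simpa using hstep n Set.univ MeasurableSet.univ
  have hfin : ∀ n, ∫⁻ ω, Z n ω ∂μ ≠ ⊤ := fun n => ne_top_of_le_ne_top h0 (hle n)
  have hae : ∀ n, ∀ᵐ ω ∂μ, Z n ω < ⊤ := fun n => ae_lt_top (hZ' n) (hfin n)
  have hint : ∀ n, Integrable (fun ω => (Z n ω).toReal) μ := fun n =>
    integrable_toReal_of_lintegral_ne_top (hZ' n).aemeasurable (hfin n)
  have hset : ∀ n A, ∫ ω in A, (Z n ω).toReal ∂μ = (∫⁻ ω in A, Z n ω ∂μ).toReal := fun n A =>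
    integral_toReal (hZ' n).aemeasurable (ae_restrict_of_ae (hae n))
  have hsuper : Supermartingale (fun n ω => (Z n ω).toReal) F μ := by
    refine supermartingale_of_setIntegral_succ_le
      (fun n => (hZ n).ennreal_toReal.stronglyMeasurable) hint fun n A hA => ?_
    rw [hset, hset]
    exact ENNReal.toReal_mono
      (ne_top_of_le_ne_top (hfin n) (setLIntegral_le_lintegral _ _)) (hstep n A hA)
  have hconv := hsuper.neg.exists_ae_tendsto_of_bdd (R := (∫⁻ ω, Z 0 ω ∂μ).toNNReal) fun n => by
    rw [ENNReal.coe_toNNReal h0, Pi.neg_apply, eLpNorm_neg, eLpNorm_one_eq_lintegral_enorm]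
    refine le_trans (lintegral_mono fun ω => ?_) (hle n)
    rw [Real.enorm_of_nonneg ENNReal.toReal_nonneg]
    exact ENNReal.ofReal_toReal_le
  filter_upwards [hconv, ae_all_iff.2 hae] with ω ⟨c, hc⟩ hω
  refine ⟨ENNReal.ofReal (-c), ENNReal.ofReal_ne_top, ?_⟩
  have := ENNReal.tendsto_ofReal hc.neg
  simpa [ENNReal.ofReal_toReal (hω _).ne] using this

/-- A sequence of non-negative functions converging almost everywhere, whose integrals tend to
zero, converges to zero. -/
theorem ae_tendsto_zero_of_tendsto_lintegral {Ω : Type*} {mΩ : MeasurableSpace Ω}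
    {μ : Measure Ω} {Z : ℕ → Ω → ENNReal} (hZ : ∀ n, Measurable (Z n))
    (hconv : ∀ᵐ ω ∂μ, ∃ l, l ≠ ⊤ ∧ Tendsto (fun n => Z n ω) atTop (𝓝 l))
    (hlim : Tendsto (fun n => ∫⁻ ω, Z n ω ∂μ) atTop (𝓝 0)) :
    ∀ᵐ ω ∂μ, Tendsto (fun n => Z n ω) atTop (𝓝 0) := by
  have h := lintegral_liminf_le (μ := μ) (u := atTop) hZ
  rw [hlim.liminf_eq, nonpos_iff_eq_zero, lintegral_eq_zero_iff (Measurable.liminf hZ)] at h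
  filter_upwards [h, hconv] with ω hω ⟨l, _, hl⟩
  rw [hl.liminf_eq] at hω
  rwa [hω] at hl

namespace IsBranchingWeight

variable {S Ω : Type*} [DecidableEq S] [Countable S] {mΩ : MeasurableSpace Ω} {μ : Measure Ω}
  {F : Filtration ℕ mΩ} {p : S → S → ENNReal} {o : S} {w : ℕ → Ω → S → ENNReal}

theorem measurable_pairing (h : IsBranchingWeight μ F p o w) (u : S → ENNReal) (n : ℕ) :
    Measurable[F n] fun ω => ∑' x, w n ω x * u x :=
  @Measurable.tsum _ _ _ (F n) _ _ _ _ _ _ _ _ _ _ _ _ fun x => (h.measurable n x).mul_const _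

theorem setLIntegral_pairing_succ (h : IsBranchingWeight μ F p o w) (u : S → ENNReal) (n : ℕ)
    {A : Set Ω} (hA : MeasurableSet[F n] A) :
    ∫⁻ ω in A, ∑' x, w (n + 1) ω x * u x ∂μ =
      ∫⁻ ω in A, ∑' y, w n ω y * kernelOp p u y ∂μ := by
  have hm : ∀ k x, Measurable fun ω => w k ω x := fun k x => (h.measurable k x).mono (F.le k) le_rfl
  have hs : ∀ x, Measurable fun ω => ∑' y, w n ω y * p y x := fun x =>
    Measurable.tsum fun y => (hm n y).mul_const _
  rw [lintegral_tsum fun x => ((hm _ x).mul_const _).aemeasurable]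
  simp_rw [lintegral_mul_const _ (hm _ _), h.step n _ A hA, ← lintegral_mul_const _ (hs _)]
  rw [← lintegral_tsum fun x => ((hs x).mul_const _).aemeasurable]
  refine lintegral_congr fun ω => ?_
  simp_rw [kernelOp, ← ENNReal.tsum_mul_right, ← ENNReal.tsum_mul_left]
  rw [ENNReal.tsum_comm]
  simp_rw [mul_assoc]

omit [Countable S] in
theorem pairing_zero (h : IsBranchingWeight μ F p o w) (u : S → ENNReal) (ω : Ω) :
    ∑' x, w 0 ω x * u x = u o := by
  rw [tsum_eq_single o fun x hx => by simp [h.start, hx]]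
  simp [h.start]

theorem lintegral_pairing [IsProbabilityMeasure μ] (h : IsBranchingWeight μ F p o w)
    (u : S → ENNReal) (n : ℕ) :
    ∫⁻ ω, ∑' x, w n ω x * u x ∂μ = (kernelOp p)^[n] u o := by
  induction n generalizing u with
  | zero => simp [h.pairing_zero]
  | succ n ih =>
    rw [Function.iterate_succ_apply, ← ih]
    simpa using h.setLIntegral_pairing_succ u n MeasurableSet.univ

theorem ae_exists_tendsto_pairing [IsProbabilityMeasure μ] (h : IsBranchingWeight μ F p o w)
    {u : S → ENNReal} (hu : kernelOp p u ≤ u) (huo : u o ≠ ⊤) :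
    ∀ᵐ ω ∂μ, ∃ l, l ≠ ⊤ ∧ Tendsto (fun n => ∑' x, w n ω x * u x) atTop (𝓝 l) := by
  refine ae_exists_tendsto_of_setLIntegral_succ_le (F := F) (h.measurable_pairing u) ?_ ?_
  · simpa [h.pairing_zero] using huo
  · intro n A hA
    rw [h.setLIntegral_pairing_succ u n hA]
    gcongr with ω y
    exact hu y

theorem ae_tendsto_pairing_zero [IsProbabilityMeasure μ] (h : IsBranchingWeight μ F p o w)
    {u : S → ENNReal} (hu : kernelOp p u ≤ u) (huo : u o ≠ ⊤)
    (hlim : Tendsto (fun n => (kernelOp p)^[n] u o) atTop (𝓝 0)) :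
    ∀ᵐ ω ∂μ, Tendsto (fun n => ∑' x, w n ω x * u x) atTop (𝓝 0) := by
  refine ae_tendsto_zero_of_tendsto_lintegral
    (fun n => (h.measurable_pairing u n).mono (F.le n) le_rfl)
    (h.ae_exists_tendsto_pairing hu huo) ?_
  simpa only [h.lintegral_pairing] using hlim

end IsBranchingWeight

/-- The rescaled configurations of a branching random walk form a branching weight. -/
theorem isBranchingWeight_of_condExp {S : Type*} [DecidableEq S] [Countable S] {P : S → S → ℝ}
    (hP0 : ∀ x y, 0 ≤ P x y) {m : ℝ} (hm : 0 < m) {o : S} {Ω : Type*} {mΩ : MeasurableSpace Ω}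
    {μ : Measure Ω} [IsProbabilityMeasure μ] {F : Filtration ℕ mΩ} {B : ℕ → Ω → S → ℕ}
    (hadapt : ∀ n x, Measurable[F n] (fun ω => B n ω x))
    (hfin : ∀ n ω, (Function.support (B n ω)).Finite)
    (hint : ∀ n x, Integrable (fun ω => (B n ω x : ℝ)) μ)
    (hB0 : ∀ ω x, B 0 ω x = if x = o then 1 else 0)
    (hbranch : ∀ n x, μ[fun ω => (B (n + 1) ω x : ℝ)|F n]
      =ᵐ[μ] fun ω => m * ∑' y, (B n ω y : ℝ) * P y x) :
    IsBranchingWeight μ F (fun x y => ENNReal.ofReal (P x y)) o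
      fun n ω x => ENNReal.ofReal ((m ^ n)⁻¹ * (B n ω x : ℝ)) where
  measurable n x := by
    have hcast : Measurable[F n] fun ω => (B n ω x : ℝ) := measurable_from_top.comp (hadapt n x)
    exact (hcast.const_mul _).ennreal_ofReal
  start ω x := by
    rw [hB0]
    split_ifs <;> simp
  step n x A hA := by
    have hAm := F.le n A hA
    have hmn : 0 ≤ (m ^ (n + 1))⁻¹ := by positivity
    have hsum0 : ∀ ω, 0 ≤ ∑' y, (B n ω y : ℝ) * P y x := fun ω =>
      tsum_nonneg fun y => mul_nonneg (Nat.cast_nonneg _) (hP0 y x)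
    have hsint : Integrable (fun ω => m * ∑' y, (B n ω y : ℝ) * P y x) μ :=
      integrable_condExp.congr (hbranch n x)
    have hreal : ∫ ω in A, (B (n + 1) ω x : ℝ) ∂μ =
        ∫ ω in A, m * ∑' y, (B n ω y : ℝ) * P y x ∂μ := by
      rw [← setIntegral_condExp (F.le n) (hint (n + 1) x) hA]
      exact setIntegral_congr_ae hAm ((hbranch n x).mono fun ω h _ => h)
    rw [← ofReal_integral_eq_lintegral_ofReal ((hint _ x).const_mul _).integrableOn
      (ae_of_all _ fun ω => mul_nonneg hmn (Nat.cast_nonneg _)), integral_const_mul, hreal,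
      ← integral_const_mul, ofReal_integral_eq_lintegral_ofReal (hsint.const_mul _).integrableOn
      (ae_of_all _ fun ω => mul_nonneg hmn (mul_nonneg hm.le (hsum0 ω)))]
    refine lintegral_congr fun ω => ?_
    have hsupp : (Function.support fun y => (m ^ n)⁻¹ * (B n ω y : ℝ) * P y x).Finite :=
      (hfin n ω).subset fun y hy hy' => hy (by simp [hy'])
    have hterm0 : ∀ y, 0 ≤ (m ^ n)⁻¹ * (B n ω y : ℝ) := fun y => by positivity
    simp_rw [← ENNReal.ofReal_mul (hterm0 _)]
    rw [← ENNReal.ofReal_tsum_of_nonneg (fun y => mul_nonneg (hterm0 y) (hP0 y x))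
      (summable_of_hasFiniteSupport hsupp)]
    simp_rw [mul_assoc, tsum_mul_left]
    congr 1
    field_simp
    ring

/-- `Q x` is the law on trajectories of the Markov chain with kernel `p` started at `x`. -/
structure IsTrajectoryLaw {S : Type*} [DecidableEq S] [MeasurableSpace S] (p : S → S → ENNReal)
    (Q : S → Measure (ℕ → S)) : Prop where
  prob : ∀ x, IsProbabilityMeasure (Q x)
  cyl : ∀ (x : S) (n : ℕ) (s : ℕ → S), Q x {ω | ∀ i ≤ n, ω i = s i} =
    (if s 0 = x then 1 else 0) * ∏ i ∈ Finset.range n, p (s i) (s (i + 1))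

/-- Finite measures on trajectories in a countable space are determined by initial cylinders. -/
theorem measure_trajectory_ext {S : Type*} [Countable S] [MeasurableSpace S]
    [MeasurableSingletonClass S] {ν₁ ν₂ : Measure (ℕ → S)} [IsFiniteMeasure ν₂]
    (h : ∀ (n : ℕ) (s : ℕ → S),
      ν₁ {ω | ∀ i ≤ n, ω i = s i} = ν₂ {ω | ∀ i ≤ n, ω i = s i}) : ν₁ = ν₂ := by
  have hmarg : ∀ n, ν₁.map (Preorder.frestrictLe n) = ν₂.map (Preorder.frestrictLe n) := by
    intro n
    refine Measure.ext_of_singleton fun a => ?_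
    rw [Measure.map_apply (by fun_prop) (measurableSet_singleton a),
      Measure.map_apply (by fun_prop) (measurableSet_singleton a)]
    let s : ℕ → S := fun i =>
      if hi : i ≤ n then a ⟨i, Finset.mem_Iic.2 hi⟩ else a ⟨0, Finset.mem_Iic.2 n.zero_le⟩
    have hpre : (Preorder.frestrictLe n ⁻¹' {a} : Set (ℕ → S)) = {ω | ∀ i ≤ n, ω i = s i} := by
      ext ω
      simp only [Set.mem_preimage, Set.mem_singleton_iff, Set.mem_ofPred_eq]
      constructor
      · rintro rfl i hi
        simp [s, hi]
      · intro hω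
        ext ⟨i, hi⟩
        have hi' := Finset.mem_Iic.1 hi
        simp [hω i hi', s, hi']
    rw [hpre, h]
  have hfam : IsProjectiveMeasureFamily fun I : Finset ℕ => ν₂.map I.restrict := by
    intro I J hJI
    rw [Measure.map_map (by fun_prop) (by fun_prop)]
    rfl
  have h₂ : IsProjectiveLimit ν₂ fun I : Finset ℕ => ν₂.map I.restrict := fun I => rfl
  exact IsProjectiveLimit.unique ((isProjectiveLimit_nat_iff hfam ν₁).2 hmarg) h₂

/-- The upper envelopes of the tails of a convergent sequence converge to its limit. -/
theorem tendsto_iSup_tail {a : ℕ → ENNReal} {l : ENNReal} (h : Tendsto a atTop (𝓝 l)) :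
    Tendsto (fun n => ⨆ k, a (k + n)) atTop (𝓝 l) := by
  rw [← h.limsup_eq, limsup_eq_iInf_iSup_of_nat']
  refine tendsto_atTop_iInf fun i j hij => iSup_le fun k => ?_
  exact le_iSup_of_le (k + (j - i)) (by rw [show k + (j - i) + i = k + j by omega])

/-- The lower envelopes of the tails of a convergent sequence converge to its limit. -/
theorem tendsto_iInf_tail {a : ℕ → ENNReal} {l : ENNReal} (h : Tendsto a atTop (𝓝 l)) :
    Tendsto (fun n => ⨅ k, a (k + n)) atTop (𝓝 l) := by
  rw [← h.liminf_eq, liminf_eq_iSup_iInf_of_nat']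
  refine tendsto_atTop_iSup fun i j hij => le_iInf fun k => ?_
  exact iInf_le_of_le (k + (j - i)) (by rw [show k + (j - i) + i = k + j by omega])

namespace IsTrajectoryLaw

variable {S : Type*} [DecidableEq S] [Countable S] [MeasurableSpace S]
  [MeasurableSingletonClass S] {p : S → S → ENNReal} {Q : S → Measure (ℕ → S)}

omit [Countable S] [MeasurableSingletonClass S] in
theorem measure_initial (h : IsTrajectoryLaw p Q) (x : S) : Q x {ω | ω 0 = x} = 1 := by
  simpa using h.cyl x 0 fun _ => x

theorem ae_initial (h : IsTrajectoryLaw p Q) (x : S) : ∀ᵐ ω ∂Q x, ω 0 = x := by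
  have := h.prob x
  exact (prob_compl_eq_zero_iff (measurableSet_eq_fun (by fun_prop) (by fun_prop))).2
    (h.measure_initial x)

/-- The Markov property at time one. -/
theorem map_shift (h : IsTrajectoryLaw p Q) (x : S) :
    (Q x).map (fun ω i => ω (i + 1)) = Measure.sum fun y => p x y • Q y := by
  have := h.prob x
  have hshift : Measurable fun (ω : ℕ → S) i => ω (i + 1) := by fun_prop
  have := Measure.isFiniteMeasure_map (Q x) fun (ω : ℕ → S) i => ω (i + 1)
  refine (measure_trajectory_ext fun n s => ?_).symm
  have hmeas : MeasurableSet {ω : ℕ → S | ∀ i ≤ n, ω i = s i} := by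
    simp only [Set.ofPred_forall]
    exact MeasurableSet.iInter fun i => MeasurableSet.iInter fun _ =>
      measurableSet_eq_fun (by fun_prop) (by fun_prop)
  rw [Measure.sum_apply _ hmeas, Measure.map_apply hshift hmeas, tsum_eq_single (s 0)
    fun y hy => by simp [h.cyl, hy.symm]]
  let t : ℕ → S := fun i => Nat.rec x (fun k _ => s k) i
  have hpre : Q x ((fun (ω : ℕ → S) i => ω (i + 1)) ⁻¹' {ω | ∀ i ≤ n, ω i = s i}) =
      Q x {ω | ∀ i ≤ n + 1, ω i = t i} := by
    refine measure_congr ?_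
    filter_upwards [h.ae_initial x] with ω hω
    refine propext ⟨fun hs i hi => ?_, fun ht i hi => ht (i + 1) (by omega)⟩
    cases i with
    | zero => exact hω
    | succ i => exact hs i (by omega)
  rw [hpre, h.cyl, Finset.prod_range_succ']
  simp [h.cyl, t, mul_comm]

theorem kernelOp_lintegral (h : IsTrajectoryLaw p Q) {V : (ℕ → S) → ENNReal} (hV : Measurable V)
    (x : S) : kernelOp p (fun y => ∫⁻ ω, V ω ∂Q y) x = ∫⁻ ω, V (fun i => ω (i + 1)) ∂Q x := by
  have hmap := lintegral_map (μ := Q x) (g := fun ω i => ω (i + 1)) hV (by fun_prop)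
  rw [← hmap, h.map_shift, lintegral_sum_measure]
  simp [kernelOp]

theorem iterate_kernelOp_lintegral (h : IsTrajectoryLaw p Q) {V : (ℕ → S) → ENNReal}
    (hV : Measurable V) (n : ℕ) (x : S) :
    (kernelOp p)^[n] (fun y => ∫⁻ ω, V ω ∂Q y) x = ∫⁻ ω, V (fun i => ω (i + n)) ∂Q x := by
  induction n generalizing V with
  | zero => rfl
  | succ n ih =>
    rw [Function.iterate_succ_apply, funext (h.kernelOp_lintegral hV),
      ih (V := fun ω => V fun i => ω (i + 1)) (hV.comp (by fun_prop))]
    simp only [add_assoc, add_comm 1 n]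

end IsTrajectoryLaw

section PairingConvergence

variable {S Ω : Type*} [DecidableEq S] [Countable S] [MeasurableSpace S]
  [MeasurableSingletonClass S] {mΩ : MeasurableSpace Ω} {μ : Measure Ω} [IsProbabilityMeasure μ]
  {F : Filtration ℕ mΩ} {p : S → S → ENNReal} {o : S} {w : ℕ → Ω → S → ENNReal}
  {Q : S → Measure (ℕ → S)}

/-- If a bounded functional of the trajectory does not increase under the shift, then its
expectation is a superharmonic function, so that its pairings with a branching weight
converge. -/
theorem IsBranchingWeight.ae_exists_tendsto_lintegral (hw : IsBranchingWeight μ F p o w)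
    (hQ : IsTrajectoryLaw p Q) {V : (ℕ → S) → ENNReal} (hV : Measurable V)
    (hshift : ∀ ω, V (fun i => ω (i + 1)) ≤ V ω) {K : ENNReal} (hK : K ≠ ⊤) (hVK : ∀ ω, V ω ≤ K) :
    ∀ᵐ ω ∂μ, ∃ l, l ≠ ⊤ ∧
      Tendsto (fun n => ∑' x, w n ω x * ∫⁻ ξ, V ξ ∂Q x) atTop (𝓝 l) := by
  have := hQ.prob o
  refine hw.ae_exists_tendsto_pairing (fun x => ?_) ?_
  · rw [hQ.kernelOp_lintegral hV]
    exact lintegral_mono hshift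
  · exact ne_top_of_le_ne_top hK ((lintegral_mono hVK).trans (by simp))

/-- If moreover the functional tends to zero along the shifts of almost every trajectory, then
the pairings tend to zero. -/
theorem IsBranchingWeight.ae_tendsto_lintegral_zero (hw : IsBranchingWeight μ F p o w)
    (hQ : IsTrajectoryLaw p Q) {V : (ℕ → S) → ENNReal} (hV : Measurable V)
    (hshift : ∀ ω, V (fun i => ω (i + 1)) ≤ V ω) {K : ENNReal} (hK : K ≠ ⊤) (hVK : ∀ ω, V ω ≤ K)
    (hlim : ∀ᵐ ξ ∂Q o, Tendsto (fun n => V fun i => ξ (i + n)) atTop (𝓝 0)) :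
    ∀ᵐ ω ∂μ, Tendsto (fun n => ∑' x, w n ω x * ∫⁻ ξ, V ξ ∂Q x) atTop (𝓝 0) := by
  have := hQ.prob o
  refine hw.ae_tendsto_pairing_zero (fun x => ?_) ?_ ?_
  · rw [hQ.kernelOp_lintegral hV]
    exact lintegral_mono hshift
  · exact ne_top_of_le_ne_top hK ((lintegral_mono hVK).trans (by simp))
  · simp_rw [hQ.iterate_kernelOp_lintegral hV]
    have := tendsto_lintegral_of_dominated_convergence (μ := Q o)
      (F := fun n ξ => V fun i => ξ (i + n)) (f := fun _ => 0) (fun _ => K)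
      (fun n => hV.comp (by fun_prop)) (fun n => ae_of_all _ fun ξ => hVK _) (by simpa using hK)
      hlim
    simpa using this

variable {f : S → ENNReal} {K : ENNReal} {L : (ℕ → S) → ENNReal}

theorem IsTrajectoryLaw.le_lintegral_iSup (hQ : IsTrajectoryLaw p Q) (x : S) :
    f x ≤ ∫⁻ ξ, ⨆ n, f (ξ n) ∂Q x := by
  have := hQ.prob x
  calc f x = ∫⁻ _, f x ∂Q x := by simp
    _ ≤ _ := lintegral_mono_ae ((hQ.ae_initial x).mono fun ξ hξ => le_iSup_of_le 0 (by rw [hξ]))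

theorem IsTrajectoryLaw.lintegral_iSup_le (hQ : IsTrajectoryLaw p Q) (x : S) :
    ∫⁻ ξ, ⨆ n, f (ξ n) ∂Q x ≤ f x + ∫⁻ ξ, ((⨆ n, f (ξ n)) - ⨅ n, f (ξ n)) ∂Q x := by
  have := hQ.prob x
  calc ∫⁻ ξ, ⨆ n, f (ξ n) ∂Q x ≤ ∫⁻ ξ, (f x + ((⨆ n, f (ξ n)) - ⨅ n, f (ξ n))) ∂Q x := by
        refine lintegral_mono_ae ((hQ.ae_initial x).mono fun ξ hξ => ?_)
        refine le_add_tsub.trans (add_le_add_left (iInf_le_of_le 0 (by rw [hξ])) _)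
    _ = _ := by rw [lintegral_add_left measurable_const]; simp

/-- If a bounded non-negative function converges along almost every trajectory, then its pairings
with a branching weight converge almost surely. -/
theorem IsBranchingWeight.ae_exists_tendsto_of_trajectory (hw : IsBranchingWeight μ F p o w)
    (hQ : IsTrajectoryLaw p Q) (hK : K ≠ ⊤) (hfK : ∀ x, f x ≤ K)
    (hlim : ∀ᵐ ξ ∂Q o, Tendsto (fun n => f (ξ n)) atTop (𝓝 (L ξ))) :
    ∀ᵐ ω ∂μ, ∃ l, l ≠ ⊤ ∧ Tendsto (fun n => ∑' x, w n ω x * f x) atTop (𝓝 l) := by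
  have hf : Measurable f := measurable_of_countable f
  have hsup : Measurable fun ξ : ℕ → S => ⨆ n, f (ξ n) := by fun_prop
  have hinf : Measurable fun ξ : ℕ → S => ⨅ n, f (ξ n) := by fun_prop
  have hsup_shift : ∀ ξ : ℕ → S, ⨆ n, f (ξ (n + 1)) ≤ ⨆ n, f (ξ n) := fun ξ =>
    iSup_le fun n => le_iSup (fun k => f (ξ k)) (n + 1)
  have hinf_shift : ∀ ξ : ℕ → S, ⨅ n, f (ξ n) ≤ ⨅ n, f (ξ (n + 1)) := fun ξ =>
    le_iInf fun n => iInf_le (fun k => f (ξ k)) (n + 1)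
  have hsupK : ∀ ξ : ℕ → S, ⨆ n, f (ξ n) ≤ K := fun ξ => iSup_le fun n => hfK _
  have hU := hw.ae_exists_tendsto_lintegral hQ hsup hsup_shift hK hsupK
  have hD := hw.ae_tendsto_lintegral_zero hQ (hsup.sub hinf)
    (fun ξ => tsub_le_tsub (hsup_shift ξ) (hinf_shift ξ)) hK
    (fun ξ => tsub_le_self.trans (hsupK ξ)) (by
      filter_upwards [hlim] with ξ hξ
      have hL : L ξ ≠ ⊤ := ne_top_of_le_ne_top hK (le_of_tendsto' hξ fun n => hfK _)
      simpa using ENNReal.Tendsto.sub (tendsto_iSup_tail hξ) (tendsto_iInf_tail hξ) (Or.inl hL))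
  filter_upwards [hU, hD] with ω ⟨l, hl, hUl⟩ hD0
  refine ⟨l, hl, ?_⟩
  have hsub := ENNReal.Tendsto.sub hUl hD0 (Or.inl hl)
  rw [tsub_zero] at hsub
  refine tendsto_of_tendsto_of_tendsto_of_le_of_le hsub hUl (fun n => ?_) fun n => ?_
  · rw [tsub_le_iff_right, ← ENNReal.tsum_add]
    refine ENNReal.tsum_le_tsum fun x => ?_
    rw [← mul_add]
    gcongr
    exact hQ.lintegral_iSup_le x
  · refine ENNReal.tsum_le_tsum fun x => ?_
    gcongr
    exact hQ.le_lintegral_iSup x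

/-- If a bounded non-negative function tends to zero along almost every trajectory, then so do its
pairings with a branching weight. -/
theorem IsBranchingWeight.ae_tendsto_zero_of_trajectory (hw : IsBranchingWeight μ F p o w)
    (hQ : IsTrajectoryLaw p Q) (hK : K ≠ ⊤) (hfK : ∀ x, f x ≤ K)
    (hlim : ∀ᵐ ξ ∂Q o, Tendsto (fun n => f (ξ n)) atTop (𝓝 0)) :
    ∀ᵐ ω ∂μ, Tendsto (fun n => ∑' x, w n ω x * f x) atTop (𝓝 0) := by
  have hf : Measurable f := measurable_of_countable f
  have hU := hw.ae_tendsto_lintegral_zero hQ (V := fun ξ => ⨆ n, f (ξ n)) (by fun_prop)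
    (fun ξ => iSup_le fun n => le_iSup (fun k => f (ξ k)) (n + 1)) hK
    (fun ξ => iSup_le fun n => hfK _) (hlim.mono fun ξ hξ => tendsto_iSup_tail hξ)
  filter_upwards [hU] with ω hω
  refine tendsto_of_tendsto_of_tendsto_of_le_of_le tendsto_const_nhds hω (fun n => zero_le)
    fun n => ENNReal.tsum_le_tsum fun x => ?_
  gcongr
  exact hQ.le_lintegral_iSup x

end PairingConvergence

theorem lintegral_brwMeasure {S C : Type*} [MeasurableSpace C] (ι : S → C) (w : S → ENNReal)
    {g : C → ENNReal} (hg : Measurable g) :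
    ∫⁻ c, g c ∂brwMeasure ι w = ∑' x, w x * g (ι x) := by
  simp [brwMeasure, lintegral_sum_measure, lintegral_dirac' _ hg]

section WeakLimit

variable {C : Type*} [TopologicalSpace C] [CompactSpace C] [MeasurableSpace C] [BorelSpace C]

/-- Convergence of the integrals of all continuous functions on a compact space against measures
of bounded mass follows from convergence for a dense set of functions. -/
theorem exists_tendsto_integral_of_dense {ν : ℕ → Measure C} [∀ n, IsFiniteMeasure (ν n)] {M : ℝ}
    (hM : ∀ n, (ν n).real Set.univ ≤ M) {D : Set C(C, ℝ)} (hD : Dense D)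
    (hconv : ∀ f ∈ D, ∃ l, Tendsto (fun n => ∫ c, f c ∂ν n) atTop (𝓝 l)) (f : C(C, ℝ)) :
    ∃ l, Tendsto (fun n => ∫ c, f c ∂ν n) atTop (𝓝 l) := by
  have hM0 : 0 ≤ M := measureReal_nonneg.trans (hM 0)
  have hint : ∀ (g : C(C, ℝ)) n, Integrable g (ν n) := fun g n =>
    (BoundedContinuousFunction.mkOfCompact g).integrable (ν n)
  refine cauchySeq_tendsto_of_complete (Metric.cauchySeq_iff'.2 fun ε hε => ?_)
  obtain ⟨g, hgD, hfg⟩ := Metric.dense_iff.1 hD f (ε / (3 * (M + 1))) (by positivity)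
  have hfg' : ‖f - g‖ * M ≤ ε / 3 := by
    have h1 : ‖f - g‖ ≤ ε / (3 * (M + 1)) := by
      rw [Metric.mem_ball, dist_comm, dist_eq_norm] at hgD
      exact hgD.le
    calc ‖f - g‖ * M ≤ ε / (3 * (M + 1)) * (M + 1) := by gcongr; linarith
      _ = ε / 3 := by field_simp
  have happrox : ∀ n, |∫ c, f c ∂ν n - ∫ c, g c ∂ν n| ≤ ε / 3 := fun n => by
    rw [← integral_sub (hint f n) (hint g n), ← Real.norm_eq_abs]
    calc ‖∫ c, (f c - g c) ∂ν n‖ ≤ ‖f - g‖ * (ν n).real Set.univ :=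
          norm_integral_le_of_norm_le_const (ae_of_all _ fun c => (f - g).norm_coe_le_norm c)
      _ ≤ ‖f - g‖ * M := by gcongr; exact hM n
      _ ≤ ε / 3 := hfg'
  obtain ⟨l, hl⟩ := hconv g hfg
  obtain ⟨N, hN⟩ := Metric.cauchySeq_iff'.1 hl.cauchySeq (ε / 3) (by positivity)
  refine ⟨N, fun n hn => ?_⟩
  have h1 := abs_le.1 (happrox n)
  have h2 := abs_le.1 (happrox N)
  have h3 := abs_lt.1 (by simpa [Real.dist_eq] using hN n hn)
  rw [Real.dist_eq, abs_lt]
  constructor <;> linarith [h1.1, h1.2, h2.1, h2.2, h3.1, h3.2]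

/-- If the integrals of all continuous functions on a compact Hausdorff space converge, then the
limits are the integrals against some finite measure. -/
theorem exists_weak_limit [T2Space C] {ν : ℕ → Measure C} [∀ n, IsFiniteMeasure (ν n)]
    (hconv : ∀ f : C(C, ℝ), ∃ l, Tendsto (fun n => ∫ c, f c ∂ν n) atTop (𝓝 l)) :
    ∃ W : Measure C, IsFiniteMeasure W ∧ ∀ f : BoundedContinuousFunction C ℝ,
      Tendsto (fun n => ∫ c, f c ∂ν n) atTop (𝓝 (∫ c, f c ∂W)) := by
  choose Λ hΛ using hconv
  have hint : ∀ (g : C(C, ℝ)) n, Integrable g (ν n) := fun g n =>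
    (BoundedContinuousFunction.mkOfCompact g).integrable (ν n)
  let Λ' : CompactlySupportedContinuousMap C ℝ →ₚ[ℝ] ℝ := PositiveLinearMap.mk₀
    { toFun := fun f => Λ f
      map_add' := fun f g => by
        refine tendsto_nhds_unique (hΛ _) (((hΛ f).add (hΛ g)).congr fun n => ?_)
        exact (integral_add (hint f n) (hint g n)).symm
      map_smul' := fun a f => by
        refine tendsto_nhds_unique (hΛ _) (((hΛ f).const_mul a).congr fun n => ?_)
        exact (integral_const_mul a _).symm }
    fun f hf => ge_of_tendsto' (hΛ f) fun n => integral_nonneg fun c => hf c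
  refine ⟨RealRMK.rieszMeasure Λ', inferInstance, fun f => ?_⟩
  let f' : CompactlySupportedContinuousMap C ℝ :=
    ⟨f.toContinuousMap, HasCompactSupport.of_compactSpace _⟩
  have h : ∫ c, f c ∂(RealRMK.rieszMeasure Λ') = Λ' f' := RealRMK.integral_rieszMeasure Λ' f'
  rw [h]
  exact hΛ f'

end WeakLimit

/-- Almost surely, the random measures `B̄ₙ` on `C` converge weakly to a
random finite measure `W`, and `W` is supported on `∂harm`, the support of the law of
`X_∞` under `𝐏ₒ` (the smallest closed subset of `∂` carrying all the mass of `X_∞`). -/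
theorem brw_weak_convergence
    {S : Type*} [Countable S] [DecidableEq S]
    (P : S → S → ℝ)
    (hP0 : ∀ x y, 0 ≤ P x y)
    (hP1 : ∀ x, HasSum (fun y => P x y) 1)
    (m : ℝ) (hm : 1 < m) (o : S)
    {Ω : Type*} {mΩ : MeasurableSpace Ω}
    (μ : Measure Ω) [IsProbabilityMeasure μ]
    (F : Filtration ℕ mΩ)
    (B : ℕ → Ω → S → ℕ)
    (hadapt : ∀ n x, Measurable[F n] (fun ω => B n ω x))
    (hfin : ∀ n ω, (Function.support (B n ω)).Finite)
    (hint : ∀ n x, Integrable (fun ω => (B n ω x : ℝ)) μ)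
    (hB0 : ∀ ω x, B 0 ω x = if x = o then 1 else 0)
    (hbranch : ∀ n x,
      μ[fun ω => (B (n + 1) ω x : ℝ)|F n]
        =ᵐ[μ] fun ω => m * ∑' y, (B n ω y : ℝ) * P y x)
    {C : Type*} [TopologicalSpace C] [CompactSpace C]
    [TopologicalSpace.MetrizableSpace C] [MeasurableSpace C] [BorelSpace C]
    [TopologicalSpace S] [DiscreteTopology S]
    (ι : S → C) (hι : IsOpenEmbedding ι)
    [MeasurableSpace S] [MeasurableSingletonClass S]
    (Q : S → Measure (ℕ → S))
    (hQprob : ∀ x, IsProbabilityMeasure (Q x))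
    (hQcyl : ∀ (x : S) (n : ℕ) (s : ℕ → S),
      Q x {ω | ∀ i ≤ n, ω i = s i} =
        (if s 0 = x then 1 else 0) *
          ∏ i ∈ Finset.range n, ENNReal.ofReal (P (s i) (s (i + 1))))
    (Xinf : (ℕ → S) → C)
    (hXmeas : Measurable Xinf)
    (hXconv : ∀ x : S, ∀ᵐ ω ∂(Q x),
      Xinf ω ∈ (Set.range ι)ᶜ ∧ Tendsto (fun n => ι (ω n)) atTop (𝓝 (Xinf ω)))
    (H : Set C) (hHclosed : IsClosed H) (hHsub : H ⊆ (Set.range ι)ᶜ)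
    (hHfull : Q o (Xinf ⁻¹' H) = 1)
    (hHmin : ∀ H' : Set C, IsClosed H' → H' ⊆ (Set.range ι)ᶜ →
      Q o (Xinf ⁻¹' H') = 1 → H ⊆ H') :
    ∀ᵐ ω ∂μ, ∃ W : Measure C, IsFiniteMeasure W ∧
      (∀ f : BoundedContinuousFunction C ℝ,
        Tendsto
          (fun n => ∫ c, f c
            ∂(brwMeasure ι fun x => ENNReal.ofReal ((m ^ n)⁻¹ * (B n ω x : ℝ))))
          atTop (𝓝 (∫ c, f c ∂W))) ∧
      W Hᶜ = 0 := by
  let _ := TopologicalSpace.metrizableSpaceMetric C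
  have hm0 : 0 < m := one_pos.trans hm
  have hw := isBranchingWeight_of_condExp hP0 hm0 hadapt hfin hint hB0 hbranch
  have hQ : IsTrajectoryLaw (fun x y => ENNReal.ofReal (P x y)) Q := ⟨hQprob, hQcyl⟩
  have := hQprob o
  have hXH : ∀ᵐ ξ ∂Q o, Xinf ξ ∈ H :=
    (prob_compl_eq_zero_iff (hXmeas hHclosed.measurableSet)).2 hHfull
  have hHne : H.Nonempty := by
    rw [Set.nonempty_iff_ne_empty]
    rintro rfl
    simp at hHfull
  set w : ℕ → Ω → S → ENNReal := fun n ω x => ENNReal.ofReal ((m ^ n)⁻¹ * (B n ω x : ℝ))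
  have hmeas : ∀ f : C(C, ℝ), Measurable fun c => ENNReal.ofReal (f c) := fun f =>
    f.continuous.measurable.ennreal_ofReal
  have hbdd : ∀ (f : C(C, ℝ)) c, ENNReal.ofReal (f c) ≤ ENNReal.ofReal ‖f‖ := fun f c =>
    ENNReal.ofReal_le_ofReal ((le_abs_self _).trans (f.norm_coe_le_norm c))
  have hpos : ∀ f : C(C, ℝ), ∀ᵐ ω ∂μ, ∃ l, l ≠ ⊤ ∧
      Tendsto (fun n => ∫⁻ c, ENNReal.ofReal (f c) ∂brwMeasure ι (w n ω)) atTop (𝓝 l) := fun f => by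
    simp_rw [lintegral_brwMeasure ι _ (hmeas f)]
    refine hw.ae_exists_tendsto_of_trajectory hQ (f := fun x => ENNReal.ofReal (f (ι x)))
      (L := fun ξ => ENNReal.ofReal (f (Xinf ξ))) ENNReal.ofReal_ne_top (fun x => hbdd f _) ?_
    filter_upwards [hXconv o] with ξ hξ
    exact ENNReal.tendsto_ofReal ((f.continuous.tendsto _).comp hξ.2)
  have hfinite : ∀ n ω, IsFiniteMeasure (brwMeasure ι (w n ω)) := fun n ω => by
    constructor
    rw [← lintegral_one, lintegral_brwMeasure ι _ measurable_const,
      tsum_eq_sum (s := (hfin n ω).toFinset) fun x hx => by simp_all [w]]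
    exact ENNReal.sum_lt_top.2 fun x _ => by simp [w]
  let d : C(C, ℝ) := ⟨fun c => Metric.infDist c H, Metric.continuous_infDist_pt H⟩
  have hd : ∀ᵐ ω ∂μ,
      Tendsto (fun n => ∫⁻ c, ENNReal.ofReal (d c) ∂brwMeasure ι (w n ω)) atTop (𝓝 0) := by
    simp_rw [lintegral_brwMeasure ι _ (hmeas d)]
    refine hw.ae_tendsto_zero_of_trajectory hQ (f := fun x => ENNReal.ofReal (d (ι x)))
      ENNReal.ofReal_ne_top (fun x => hbdd d _) ?_
    filter_upwards [hXconv o, hXH] with ξ hξ hξH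
    have hlim := ENNReal.tendsto_ofReal ((d.continuous.tendsto _).comp hξ.2)
    have hzero : d (Xinf ξ) = 0 := Metric.infDist_zero_of_mem hξH
    simpa [hzero] using hlim
  obtain ⟨D, hDc, hD⟩ := TopologicalSpace.exists_countable_dense C(C, ℝ)
  have hDpos := (ae_ball_iff hDc).2 fun f _ => hpos f
  have hDneg := (ae_ball_iff hDc).2 fun f _ => hpos (-f)
  filter_upwards [hDpos, hDneg, hpos 1, hd] with ω h₁ h₂ ⟨l, hl, hmass⟩ hdω
  have := fun n => hfinite n ω
  have hreal : Tendsto (fun n => (brwMeasure ι (w n ω)).real Set.univ) atTop (𝓝 l.toReal) := by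
    simpa [Measure.real, Function.comp_def] using (ENNReal.tendsto_toReal hl).comp hmass
  obtain ⟨M, hM⟩ := hreal.bddAbove_range
  have hconv := exists_tendsto_integral_of_dense (fun n => hM ⟨n, rfl⟩) hD fun f hf => by
    obtain ⟨a, ha, hfa⟩ := h₁ f hf
    obtain ⟨b, hb, hfb⟩ := h₂ f hf
    refine ⟨a.toReal - b.toReal, (((ENNReal.tendsto_toReal ha).comp hfa).sub
      ((ENNReal.tendsto_toReal hb).comp hfb)).congr fun n => ?_⟩
    exact (integral_eq_lintegral_pos_part_sub_lintegral_neg_part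
      ((BoundedContinuousFunction.mkOfCompact f).integrable _)).symm
  obtain ⟨W, hWfin, hW⟩ := exists_weak_limit hconv
  refine ⟨W, hWfin, hW, ?_⟩
  have hd0 : ∀ c, 0 ≤ d c := fun c => Metric.infDist_nonneg
  have hdint : ∫ c, d c ∂W = 0 := by
    refine tendsto_nhds_unique (hW (BoundedContinuousFunction.mkOfCompact d)) ?_
    refine ((ENNReal.tendsto_toReal ENNReal.zero_ne_top).comp hdω).congr fun n => ?_
    exact (integral_eq_lintegral_of_nonneg_ae (ae_of_all _ hd0)
      d.continuous.aestronglyMeasurable).symm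
  rw [integral_eq_zero_iff_of_nonneg hd0
    ((BoundedContinuousFunction.mkOfCompact d).integrable W)] at hdint
  have hmem : ∀ᵐ c ∂W, c ∈ H := hdint.mono fun c hc =>
    (hHclosed.mem_iff_infDist_zero hHne).2 hc
  exact hmem
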